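/- arXiv:1207.2824 — 2 statements merged into one kernel-verified Lean document; each statement's English description precedes it below -/
import Mathlib

section
/- Let R = ℂ[s^{±1}, t^{±1}] be the ring of Laurent polynomials in two variables s, t over ℂ, let Ω_R be the R-module of Kähler differentials of R over ℂ with universal derivation d : R → Ω_R, and let dR ⊆ Ω_R denote the ℂ-subspace of exact forms (the image of d). Then the images in the quotient Ω_R/dR of the elements s^{p−1}t^{q} ds for p ∈ ℤ and q ∈ ℤ \ {0}, together with s^{p}t^{−1} dt for p ∈ ℤ, together with s^{−1} ds, form a ℂ-basis of Ω_R/dR. -/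
noncomputable section

/-- The ring R = ℂ[s^{±1}, t^{±1}] of Laurent polynomials in two variables,
realized as the group algebra of ℤ² over ℂ. -/
abbrev LaurentR : Type := AddMonoidAlgebra ℂ (ℤ × ℤ)

/-- The monomial s^a t^b in R. -/
def mono (a b : ℤ) : LaurentR := AddMonoidAlgebra.of' ℂ (ℤ × ℤ) (a, b)

/-- The module of Kähler differentials Ω_R of R over ℂ. -/
abbrev OmegaR : Type := Ω[LaurentR⁄ℂ]

/-- The universal derivation d : R → Ω_R, as a ℂ-linear map. -/
def dmap : LaurentR →ₗ[ℂ] OmegaR := (KaehlerDifferential.D ℂ LaurentR).toLinearMap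

/-- The ℂ-subspace of exact forms dR ⊆ Ω_R (the image of d). -/
def exactForms : Submodule ℂ OmegaR := LinearMap.range dmap

/-- The quotient Ω_R / dR. -/
abbrev OmegaQuot : Type := OmegaR ⧸ exactForms

/-- The family of elements of Ω_R/dR: images of s^{p−1}t^{q} ds (p ∈ ℤ, q ≠ 0),
of s^{p}t^{−1} dt (p ∈ ℤ), and of s^{−1} ds. -/
def lauFam : (ℤ × {q : ℤ // q ≠ 0}) ⊕ ℤ ⊕ Unit → OmegaQuot :=
  Sum.elim
    (fun pq => Submodule.mkQ exactForms (mono (pq.1 - 1) pq.2.1 • dmap (mono 1 0)))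
    (Sum.elim
      (fun p => Submodule.mkQ exactForms (mono p (-1) • dmap (mono 0 1)))
      (fun _ => Submodule.mkQ exactForms (mono (-1) 0 • dmap (mono 1 0))))

namespace AddMonoidAlgebra

variable {k G : Type*} [CommRing k]

/-- The `k`-linear endomorphism of `k[G]` scaling the degree `g` part by `χ g`. -/
def scaleLinearMap (χ : G → k) : AddMonoidAlgebra k G →ₗ[k] AddMonoidAlgebra k G :=
  (Finsupp.lsum k fun g => χ g • (coeffLinearEquiv k).symm.toLinearMap ∘ₗ Finsupp.lsingle g) ∘ₗ
    (coeffLinearEquiv k).toLinearMap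

lemma scaleLinearMap_single (χ : G → k) (g : G) (r : k) :
    scaleLinearMap χ (single g r) = single g (χ g * r) := by
  ext
  simp [scaleLinearMap]

variable [AddCommMonoid G]

/-- The derivation of `k[G]` attached to an additive character, `X ^ g ↦ χ g • X ^ g`. -/
def characterDerivation (χ : G →+ k) :
    Derivation k (AddMonoidAlgebra k G) (AddMonoidAlgebra k G) :=
  Derivation.mk' (scaleLinearMap χ) fun a b => by
    induction a using induction_linear with
    | zero => simp
    | add f g hf hg => simp only [add_mul, map_add, hf, hg, add_smul, smul_add]; abel
    | single g r =>
      induction b using induction_linear with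
      | zero => simp
      | add f g hf hg => simp only [mul_add, map_add, hf, hg, add_smul, smul_add]; abel
      | single h s =>
        simp only [scaleLinearMap_single, single_mul_single, smul_eq_mul, map_add, add_comm h g,
          ← single_add]
        congr 1
        ring

lemma characterDerivation_single (χ : G →+ k) (g : G) (r : k) :
    characterDerivation χ (single g r) = single g (χ g * r) :=
  scaleLinearMap_single _ _ _

end AddMonoidAlgebra

open AddMonoidAlgebra

lemma coeff_characterDerivation (χ : ℤ × ℤ →+ ℂ) (m : ℤ × ℤ) (x : LaurentR) :
    (characterDerivation χ x).coeff m = χ m * x.coeff m := by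
  induction x using induction_linear with
  | zero => simp
  | add f g hf hg => simp [hf, hg, mul_add]
  | single g r =>
    by_cases h : g = m
    · subst h; simp [characterDerivation_single]
    · simp [characterDerivation_single, h]

/-- The functional on `Ω_R / dR` that contracts a form with the derivation attached to `χ` and
takes the coefficient in a degree `m` where `χ` vanishes. -/
def contractCoeff (χ : ℤ × ℤ →+ ℂ) (m : ℤ × ℤ) (h : χ m = 0) : OmegaQuot →ₗ[ℂ] ℂ :=
  exactForms.liftQ
    (Finsupp.lapply m ∘ₗ (coeffLinearEquiv ℂ).toLinearMap ∘ₗ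
      (characterDerivation χ).liftKaehlerDifferential.restrictScalars ℂ) <| by
    rintro _ ⟨x, rfl⟩
    simp [dmap, coeff_characterDerivation, h]

lemma contractCoeff_mono_smul_dmap (χ : ℤ × ℤ →+ ℂ) (m : ℤ × ℤ) (h : χ m = 0) (a b c d : ℤ) :
    contractCoeff χ m h (exactForms.mkQ (mono a b • dmap (mono c d))) =
      if (a + c, b + d) = m then χ (c, d) else 0 := by
  simp [contractCoeff, dmap, mono, of'_apply, characterDerivation_single, single_mul_single,
    Finsupp.single_apply]

/-- The additive character `(a, b) ↦ x * a + y * b` of `ℤ × ℤ`. -/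
def linearCharacter (x y : ℂ) : ℤ × ℤ →+ ℂ where
  toFun g := x * g.1 + y * g.2
  map_zero' := by simp
  map_add' g h := by simp only [Prod.fst_add, Prod.snd_add, Int.cast_add]; ring

lemma linearCharacter_apply (x y : ℂ) (a b : ℤ) :
    linearCharacter x y (a, b) = x * a + y * b := rfl

/-- The family of functionals dual to `lauFam`. -/
def lauDual : (ℤ × {q : ℤ // q ≠ 0}) ⊕ ℤ ⊕ Unit → OmegaQuot →ₗ[ℂ] ℂ :=
  Sum.elim
    (fun pq => contractCoeff (linearCharacter 1 (-(pq.1 / pq.2.1))) (pq.1, pq.2.1) <| by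
      have := pq.2.2
      rw [linearCharacter_apply]
      field_simp
      ring)
    (Sum.elim
      (fun p => contractCoeff (linearCharacter 0 1) (p, 0) <| by simp [linearCharacter_apply])
      (fun _ => contractCoeff (linearCharacter 1 0) (0, 0) <| by simp [linearCharacter_apply]))

lemma lauDual_lauFam (i j : (ℤ × {q : ℤ // q ≠ 0}) ⊕ ℤ ⊕ Unit) :
    lauDual i (lauFam j) = if j = i then 1 else 0 := by
  rcases i with ⟨p, q, hq⟩ | p | _ <;> rcases j with ⟨p', q', hq'⟩ | p' | _ <;>
    simp_all [lauDual, lauFam, contractCoeff_mono_smul_dmap, linearCharacter_apply,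
      -Submodule.mkQ_apply, eq_comm]

lemma linearIndependent_lauFam : LinearIndependent ℂ lauFam := by
  rw [linearIndependent_iff']
  intro s c hc i hi
  simpa [lauDual_lauFam, hi] using congrArg (lauDual i) hc

lemma mono_mul_mono (a b c d : ℤ) : mono a b * mono c d = mono (a + c) (b + d) := by
  simp [mono, of'_apply, single_mul_single]

lemma mono_zero_zero : mono 0 0 = 1 := rfl

lemma dmap_mul (x y : LaurentR) : dmap (x * y) = x • dmap y + y • dmap x :=
  (KaehlerDifferential.D ℂ LaurentR).leibniz x y

/-- The logarithmic differential `(a, b) ↦ d(s^a t^b) / (s^a t^b)`, an additive map. -/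
def logDiff : ℤ × ℤ →+ OmegaR :=
  AddMonoidHom.mk' (fun g => mono (-g.1) (-g.2) • dmap (mono g.1 g.2)) fun g h => by
    rw [Prod.fst_add, Prod.snd_add, ← mono_mul_mono g.1, dmap_mul, smul_add, smul_smul,
      smul_smul, mono_mul_mono, mono_mul_mono]
    rw [add_comm]
    congr 3 <;> ring

lemma logDiff_apply (a b : ℤ) : logDiff (a, b) = mono (-a) (-b) • dmap (mono a b) := rfl

lemma logDiff_eq (a b : ℤ) :
    logDiff (a, b) = a • logDiff (1, 0) + b • logDiff (0, 1) := by
  rw [← map_zsmul, ← map_zsmul, ← map_add]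
  simp

lemma mono_smul_logDiff (a b c d : ℤ) :
    mono a b • logDiff (c, d) = mono (a - c) (b - d) • dmap (mono c d) := by
  rw [logDiff_apply, smul_smul, mono_mul_mono, sub_eq_add_neg, sub_eq_add_neg]

lemma dmap_mono (a b : ℤ) :
    dmap (mono a b) =
      (a : ℂ) • mono a b • logDiff (1, 0) + (b : ℂ) • mono a b • logDiff (0, 1) := by
  have h : dmap (mono a b) = mono a b • logDiff (a, b) := by
    rw [mono_smul_logDiff, sub_self, sub_self, mono_zero_zero, one_smul]
  rw [h, logDiff_eq, smul_add, Int.cast_smul_eq_zsmul, Int.cast_smul_eq_zsmul,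
    smul_comm (mono a b) a, smul_comm (mono a b) b]

lemma single_eq_smul_mono (g : ℤ × ℤ) (r : ℂ) : (single g r : LaurentR) = r • mono g.1 g.2 := by
  simp [mono, of'_apply]

lemma exists_eq_smul_logDiff_add (ω : OmegaR) :
    ∃ x y : LaurentR, ω = x • logDiff (1, 0) + y • logDiff (0, 1) := by
  have hω : ω ∈ Submodule.span LaurentR (Set.range (KaehlerDifferential.D ℂ LaurentR)) := by
    rw [KaehlerDifferential.span_range_derivation]; trivial
  induction hω using Submodule.span_induction with
  | zero => exact ⟨0, 0, by simp⟩
  | add _ _ _ _ h₁ h₂ =>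
    obtain ⟨x, y, rfl⟩ := h₁
    obtain ⟨x', y', rfl⟩ := h₂
    exact ⟨x + x', y + y', by simp only [add_smul]; abel⟩
  | smul a _ _ h =>
    obtain ⟨x, y, rfl⟩ := h
    exact ⟨a * x, a * y, by rw [smul_add, smul_smul, smul_smul]⟩
  | mem _ h =>
    obtain ⟨f, rfl⟩ := h
    change ∃ x y : LaurentR, dmap f = _
    induction f using induction_linear with
    | zero => exact ⟨0, 0, by simp⟩
    | add f g hf hg =>
      obtain ⟨x, y, h₁⟩ := hf
      obtain ⟨x', y', h₂⟩ := hg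
      exact ⟨x + x', y + y', by rw [map_add, h₁, h₂]; simp only [add_smul]; abel⟩
    | single g r =>
      refine ⟨r • (g.1 : ℂ) • mono g.1 g.2, r • (g.2 : ℂ) • mono g.1 g.2, ?_⟩
      rw [single_eq_smul_mono, map_smul, dmap_mono]
      simp only [smul_assoc, smul_add]

lemma smul_mem_of_mono_smul_mem {S : Submodule ℂ OmegaR} {ω : OmegaR}
    (h : ∀ a b, mono a b • ω ∈ S) (x : LaurentR) : x • ω ∈ S := by
  induction x using induction_linear with
  | zero => simp
  | add f g hf hg => rw [add_smul]; exact S.add_mem hf hg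
  | single g r =>
    rw [single_eq_smul_mono, smul_assoc]
    exact S.smul_mem _ (h _ _)

lemma mkQ_dmap (x : LaurentR) : exactForms.mkQ (dmap x) = 0 := by
  rw [Submodule.mkQ_apply, Submodule.Quotient.mk_eq_zero]
  exact ⟨x, rfl⟩

lemma mkQ_dmap_mono (a b : ℤ) :
    (a : ℂ) • exactForms.mkQ (mono a b • logDiff (1, 0)) +
      (b : ℂ) • exactForms.mkQ (mono a b • logDiff (0, 1)) = 0 := by
  rw [← exactForms.mkQ.map_smul, ← exactForms.mkQ.map_smul, ← exactForms.mkQ.map_add,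
    ← dmap_mono, mkQ_dmap]

lemma lauFam_inl (p : ℤ) (q : {q : ℤ // q ≠ 0}) :
    lauFam (.inl (p, q)) = exactForms.mkQ (mono p q • logDiff (1, 0)) := by
  rw [mono_smul_logDiff, sub_zero]; rfl

lemma lauFam_inr_inl (p : ℤ) :
    lauFam (.inr (.inl p)) = exactForms.mkQ (mono p 0 • logDiff (0, 1)) := by
  rw [mono_smul_logDiff, sub_zero]; rfl

lemma lauFam_inr_inr :
    lauFam (.inr (.inr ())) = exactForms.mkQ (mono 0 0 • logDiff (1, 0)) := by
  rw [mono_smul_logDiff]; rfl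

lemma mkQ_mono_smul_logDiff_one_zero_mem (a b : ℤ) :
    exactForms.mkQ (mono a b • logDiff (1, 0)) ∈ Submodule.span ℂ (Set.range lauFam) := by
  by_cases hb : b = 0
  · subst hb
    by_cases ha : a = 0
    · subst ha
      exact Submodule.subset_span ⟨_, lauFam_inr_inr⟩
    · have h := mkQ_dmap_mono a 0
      rw [Int.cast_zero, zero_smul, add_zero, smul_eq_zero_iff_right (Int.cast_ne_zero.2 ha)] at h
      rw [h]
      exact Submodule.zero_mem _
  · exact Submodule.subset_span ⟨_, lauFam_inl a ⟨b, hb⟩⟩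

lemma mkQ_mono_smul_logDiff_zero_one_mem (a b : ℤ) :
    exactForms.mkQ (mono a b • logDiff (0, 1)) ∈ Submodule.span ℂ (Set.range lauFam) := by
  by_cases hb : b = 0
  · subst hb
    exact Submodule.subset_span ⟨_, lauFam_inr_inl a⟩
  · rw [← Submodule.smul_mem_iff _ (Int.cast_ne_zero.2 hb : (b : ℂ) ≠ 0),
      eq_neg_of_add_eq_zero_right (mkQ_dmap_mono a b)]
    exact Submodule.neg_mem _ (Submodule.smul_mem _ _ (mkQ_mono_smul_logDiff_one_zero_mem a b))

lemma span_range_lauFam : Submodule.span ℂ (Set.range lauFam) = ⊤ := by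
  rw [Submodule.eq_top_iff']
  intro ω
  obtain ⟨ω, rfl⟩ := exactForms.mkQ_surjective ω
  obtain ⟨x, y, rfl⟩ := exists_eq_smul_logDiff_add ω
  rw [← Submodule.mem_comap]
  exact Submodule.add_mem _
    (smul_mem_of_mono_smul_mem mkQ_mono_smul_logDiff_one_zero_mem x)
    (smul_mem_of_mono_smul_mem mkQ_mono_smul_logDiff_zero_one_mem y)

/-- The images in Ω_R/dR of s^{p−1}t^{q}ds (p ∈ ℤ, q ∈ ℤ \ {0}), s^{p}t^{−1}dt (p ∈ ℤ),
and s^{−1}ds form a ℂ-basis of Ω_R/dR. -/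
theorem laurent_differentials_basis :
    LinearIndependent ℂ lauFam ∧ Submodule.span ℂ (Set.range lauFam) = ⊤ := by
  exact ⟨linearIndependent_lauFam, span_range_lauFam⟩
end
end

section
/- For all 0 ≤ i, j ≤ n with i ≠ j and all m, m' ∈ ℤ, the operators on the Fock module V satisfy [x_i^+(m), x_j^−(m')] = 0, where [·,·] is the commutator of operators (note that since i ≠ j, at most one of the two operators is odd, so the super-bracket is the ordinary commutator). -/
noncomputable section

open scoped BigOperators

/-- Bosonic labels: `none` is β, `some i` is ε_{i+1} (so ε_1, …, ε_n). -/
abbrev BL (n : ℕ) := Option (Fin n)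

/-- The symmetric pairing on bosonic labels: (β|β)=1, (β|ε_i)=δ_{i1}, (ε_i|ε_j)=δ_{ij}. -/
def pairB (n : ℕ) : BL n → BL n → ℂ
  | none, none => 1
  | none, some i => if (i : ℕ) = 0 then 1 else 0
  | some i, none => if (i : ℕ) = 0 then 1 else 0
  | some i, some j => if i = j then 1 else 0

/-- Generators of Λ: unstarred bosons u(k), starred bosons u*(k), and the ghost e(k). -/
inductive TGen (n : ℕ) : Type
  | un : BL n → ℤ → TGen n
  | st : BL n → ℤ → TGen n
  | e : ℤ → TGen n

open FreeAlgebra in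
/-- Defining relations of Λ. -/
inductive TRel (n : ℕ) : FreeAlgebra ℂ (TGen n) → FreeAlgebra ℂ (TGen n) → Prop
  | unun (u v : BL n) (k l : ℤ) :
      TRel n (ι ℂ (TGen.un u k) * ι ℂ (TGen.un v l)) (ι ℂ (TGen.un v l) * ι ℂ (TGen.un u k))
  | stst (u v : BL n) (k l : ℤ) :
      TRel n (ι ℂ (TGen.st u k) * ι ℂ (TGen.st v l)) (ι ℂ (TGen.st v l) * ι ℂ (TGen.st u k))
  | unst (u v : BL n) (k l : ℤ) :
      TRel n (ι ℂ (TGen.un u k) * ι ℂ (TGen.st v l))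
        (ι ℂ (TGen.st v l) * ι ℂ (TGen.un u k) +
          algebraMap ℂ _ (if k + l = 0 then pairB n u v else 0))
  | une (u : BL n) (k l : ℤ) :
      TRel n (ι ℂ (TGen.un u k) * ι ℂ (TGen.e l)) (ι ℂ (TGen.e l) * ι ℂ (TGen.un u k))
  | ste (u : BL n) (k l : ℤ) :
      TRel n (ι ℂ (TGen.st u k) * ι ℂ (TGen.e l)) (ι ℂ (TGen.e l) * ι ℂ (TGen.st u k))
  | ee (k l : ℤ) :
      TRel n (ι ℂ (TGen.e k) * ι ℂ (TGen.e l) + ι ℂ (TGen.e l) * ι ℂ (TGen.e k))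
        (algebraMap ℂ _ (if k + l = 0 then (1 : ℂ) else 0))

/-- The algebra Λ. -/
abbrev Lam (n : ℕ) := RingQuot (TRel n)

/-- Image of a generator in Λ. -/
def gen (n : ℕ) (x : TGen n) : Lam n :=
  RingQuot.mkAlgHom ℂ (TRel n) (FreeAlgebra.ι ℂ x)

/-- The mode index of a generator. -/
def TGen.idx {n : ℕ} : TGen n → ℤ
  | .un _ k => k
  | .st _ k => k
  | .e k => k

/-- The left ideal generated by all generators of index ≥ 1. -/
def fockIdeal (n : ℕ) : Submodule (Lam n) (Lam n) :=
  Submodule.span (Lam n) {a | ∃ x : TGen n, 1 ≤ x.idx ∧ a = gen n x}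

/-- The Fock module V = Λ/I. -/
abbrev Fock (n : ℕ) := Lam n ⧸ fockIdeal n

/-- Series of unstarred bosonic generators. -/
def unS (n : ℕ) (u : BL n) : ℤ → Lam n := fun k => gen n (.un u k)
/-- Series of starred bosonic generators. -/
def stS (n : ℕ) (u : BL n) : ℤ → Lam n := fun k => gen n (.st u k)
/-- Series of ghost generators. -/
def eS (n : ℕ) : ℤ → Lam n := fun k => gen n (.e k)

/-- ε_i(·) for 1 ≤ i ≤ n (1-based index; junk value 0 outside the range). -/
def epU (n : ℕ) (i : ℕ) : ℤ → Lam n :=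
  if h : 1 ≤ i ∧ i ≤ n then unS n (some ⟨i - 1, by omega⟩) else 0
/-- ε_i*(·) for 1 ≤ i ≤ n. -/
def epSt (n : ℕ) (i : ℕ) : ℤ → Lam n :=
  if h : 1 ≤ i ∧ i ≤ n then stS n (some ⟨i - 1, by omega⟩) else 0

/-- Normal ordering of a bosonic pair :x(k)y(l): as an element of Λ. -/
def nob (n : ℕ) (x y : ℤ → Lam n) (k l : ℤ) : Lam n :=
  if k < 0 then x k * y l
  else if 0 < k then y l * x k
  else (2⁻¹ : ℂ) • (x 0 * y l + y l * x 0)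

/-- The operator on V given by the locally finite sum Σ_{k∈ℤ} f(k)·(·). -/
def sumOp (n : ℕ) (f : ℤ → Lam n) : Fock n → Fock n := fun v => ∑ᶠ k : ℤ, f k • v

/-- α_i(m), 0 ≤ i ≤ n. -/
def αop (n : ℕ) (i : ℕ) (m : ℤ) : Fock n → Fock n :=
  if i = 0 then sumOp n (fun k => (-2 : ℂ) • nob n (stS n none) (unS n none) k (m - k))
  else if i = n then sumOp n (fun k => nob n (epU n n) (epSt n n) k (m - k))
  else sumOp n (fun k =>
    nob n (epU n i) (epSt n i) k (m - k) - nob n (epU n (i + 1)) (epSt n (i + 1)) k (m - k))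

/-- x_i^+(m), 0 ≤ i ≤ n. -/
def xp (n : ℕ) (i : ℕ) (m : ℤ) : Fock n → Fock n :=
  if i = 0 then sumOp n (fun k => (2⁻¹ : ℂ) • nob n (stS n none) (stS n none) k (m - k))
  else if i = n then sumOp n (fun k => ((Real.sqrt 2 : ℝ) : ℂ) • (epU n n k * eS n (m - k)))
  else sumOp n (fun k => nob n (epU n i) (epSt n (i + 1)) k (m - k))

/-- x_i^−(m), 0 ≤ i ≤ n. -/
def xm (n : ℕ) (i : ℕ) (m : ℤ) : Fock n → Fock n :=
  if i = 0 then sumOp n (fun k => (2⁻¹ : ℂ) • nob n (unS n none) (unS n none) k (m - k))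
  else if i = n then sumOp n (fun k => (-((Real.sqrt 2 : ℝ) : ℂ)) • (epSt n n k * eS n (m - k)))
  else sumOp n (fun k => -(nob n (epU n (i + 1)) (epSt n i) k (m - k)))

/-- The vector ε_i (1 ≤ i ≤ n) as a coefficient function on bosonic labels. -/
def epsVec (n : ℕ) (i : ℕ) : BL n → ℂ
  | none => 0
  | some j => if (j : ℕ) + 1 = i then 1 else 0

/-- The vector β as a coefficient function. -/
def betaVec (n : ℕ) : BL n → ℂ
  | none => 1
  | some _ => 0

/-- Bilinear extension of the pairing to ℂ-linear combinations of β, ε_1, …, ε_n. -/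
def formC (n : ℕ) (f g : BL n → ℂ) : ℂ := ∑ u : BL n, ∑ v : BL n, f u * g v * pairB n u v

/-- The root vectors: α_0 = −2β, α_i = ε_i − ε_{i+1} (1 ≤ i ≤ n−1), α_n = ε_n. -/
def αvec (n : ℕ) (i : ℕ) : BL n → ℂ :=
  if i = 0 then fun u => -2 * betaVec n u
  else if i = n then epsVec n n
  else fun u => epsVec n i u - epsVec n (i + 1) u

section Commutation

variable {n : ℕ}

theorem gen_un_commute_un (u v : BL n) (k l : ℤ) :
    Commute (gen n (.un u k)) (gen n (.un v l)) := by
  simpa [gen, Commute, SemiconjBy] using RingQuot.mkAlgHom_rel ℂ (TRel.unun u v k l)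

theorem gen_st_commute_st (u v : BL n) (k l : ℤ) :
    Commute (gen n (.st u k)) (gen n (.st v l)) := by
  simpa [gen, Commute, SemiconjBy] using RingQuot.mkAlgHom_rel ℂ (TRel.stst u v k l)

theorem gen_un_commute_e (u : BL n) (k l : ℤ) :
    Commute (gen n (.un u k)) (gen n (.e l)) := by
  simpa [gen, Commute, SemiconjBy] using RingQuot.mkAlgHom_rel ℂ (TRel.une u k l)

theorem gen_st_commute_e (u : BL n) (k l : ℤ) :
    Commute (gen n (.st u k)) (gen n (.e l)) := by
  simpa [gen, Commute, SemiconjBy] using RingQuot.mkAlgHom_rel ℂ (TRel.ste u k l)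

theorem gen_un_mul_st (u v : BL n) (k l : ℤ) :
    gen n (.un u k) * gen n (.st v l) = gen n (.st v l) * gen n (.un u k) +
      algebraMap ℂ (Lam n) (if k + l = 0 then pairB n u v else 0) := by
  have h := RingQuot.mkAlgHom_rel ℂ (TRel.unst u v k l)
  rw [map_add, map_mul, map_mul, AlgHom.commutes] at h
  exact h

theorem gen_un_commute_st (u v : BL n) (k l : ℤ) (h : k + l = 0 → pairB n u v = 0) :
    Commute (gen n (.un u k)) (gen n (.st v l)) := by
  have h' := gen_un_mul_st u v k l
  rwa [ite_eq_right_iff.mpr h, map_zero, add_zero] at h'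

theorem gen_e_mul_e (k l : ℤ) (h : k + l ≠ 0) :
    gen n (.e k) * gen n (.e l) = -(gen n (.e l) * gen n (.e k)) := by
  have h' := RingQuot.mkAlgHom_rel ℂ (TRel.ee (n := n) k l)
  rw [map_add, map_mul, map_mul, if_neg h, map_zero, map_zero] at h'
  exact eq_neg_of_add_eq_zero_left h'

/-- Generators whose modes do not cancel commute or anticommute. -/
theorem gen_mul_gen_eq_or_eq_neg (x y : TGen n) (h : x.idx + y.idx ≠ 0) :
    gen n x * gen n y = gen n y * gen n x ∨ gen n x * gen n y = -(gen n y * gen n x) := by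
  cases x with
  | un u k =>
    left
    cases y with
    | un v l => exact gen_un_commute_un u v k l
    | st v l => exact gen_un_commute_st u v k l fun h' => absurd h' h
    | e l => exact gen_un_commute_e u k l
  | st u k =>
    left
    cases y with
    | un v l =>
      exact (gen_un_commute_st v u l k fun h' => absurd ((add_comm k l).trans h') h).symm
    | st v l => exact gen_st_commute_st u v k l
    | e l => exact gen_st_commute_e u k l
  | e k =>
    cases y with
    | un v l => exact .inl (gen_un_commute_e v l k).symm
    | st v l => exact .inl (gen_st_commute_e v l k).symm
    | e l => exact .inr (gen_e_mul_e k l h)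

theorem pairB_some_some_of_ne {i j : Fin n} (h : i ≠ j) : pairB n (some i) (some j) = 0 :=
  if_neg h

theorem epU_commute_unS (i : ℕ) (u : BL n) (k l : ℤ) : Commute (epU n i k) (unS n u l) := by
  unfold epU
  split_ifs
  exacts [gen_un_commute_un _ _ _ _, Commute.zero_left _]

theorem epSt_commute_stS (i : ℕ) (u : BL n) (k l : ℤ) : Commute (epSt n i k) (stS n u l) := by
  unfold epSt
  split_ifs
  exacts [gen_st_commute_st _ _ _ _, Commute.zero_left _]

theorem epU_commute_epU (i j : ℕ) (k l : ℤ) : Commute (epU n i k) (epU n j l) := by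
  rw [epU.eq_def n j]
  split_ifs
  exacts [epU_commute_unS _ _ _ _, Commute.zero_right _]

theorem epSt_commute_epSt (i j : ℕ) (k l : ℤ) : Commute (epSt n i k) (epSt n j l) := by
  rw [epSt.eq_def n j]
  split_ifs
  exacts [epSt_commute_stS _ _ _ _, Commute.zero_right _]

theorem epU_commute_eS (i : ℕ) (k l : ℤ) : Commute (epU n i k) (eS n l) := by
  unfold epU
  split_ifs
  exacts [gen_un_commute_e _ _ _, Commute.zero_left _]

theorem epSt_commute_eS (i : ℕ) (k l : ℤ) : Commute (epSt n i k) (eS n l) := by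
  unfold epSt
  split_ifs
  exacts [gen_st_commute_e _ _ _, Commute.zero_left _]

theorem epU_commute_epSt {i j : ℕ} (h : i ≠ j) (k l : ℤ) :
    Commute (epU n i k) (epSt n j l) := by
  unfold epU epSt
  split_ifs
  · refine gen_un_commute_st _ _ _ _ fun _ => pairB_some_some_of_ne ?_
    rw [Ne, Fin.mk.injEq]
    omega
  exacts [Commute.zero_right _, Commute.zero_left _, Commute.zero_left _]

theorem epU_commute_stS_none {i : ℕ} (h : i ≠ 1) (k l : ℤ) :
    Commute (epU n i k) (stS n none l) := by
  unfold epU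
  split_ifs
  · refine gen_un_commute_st _ _ _ _ fun _ => if_neg ?_
    simp only
    omega
  · exact Commute.zero_left _

theorem unS_none_commute_epSt {i : ℕ} (h : i ≠ 1) (k l : ℤ) :
    Commute (unS n none k) (epSt n i l) := by
  unfold epSt
  split_ifs
  · refine gen_un_commute_st _ _ _ _ fun _ => if_neg ?_
    simp only
    omega
  · exact Commute.zero_right _

theorem commute_nob {x y : ℤ → Lam n} {a : Lam n} (hx : ∀ k, Commute a (x k))
    (hy : ∀ k, Commute a (y k)) (k l : ℤ) : Commute a (nob n x y k l) := by
  unfold nob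
  split_ifs
  · exact (hx _).mul_right (hy _)
  · exact (hy _).mul_right (hx _)
  · exact (((hx _).mul_right (hy _)).add_right ((hy _).mul_right (hx _))).smul_right _

theorem nob_eq_mul {x y : ℤ → Lam n} (h : ∀ k l, Commute (x k) (y l)) (k l : ℤ) :
    nob n x y k l = x k * y l := by
  unfold nob
  split_ifs with h₁ h₂
  · rfl
  · exact (h k l).eq.symm
  · obtain rfl : k = 0 := by omega
    rw [← (h 0 l).eq, ← two_smul ℂ, smul_smul, inv_mul_cancel₀ two_ne_zero, one_smul]

end Commutation

section LocalFiniteness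

variable {n : ℕ}

/-- Generators of sufficiently large mode act by zero on `v`. -/
def EventuallyKilled (v : Fock n) : Prop :=
  ∃ N : ℤ, ∀ x : TGen n, N ≤ x.idx → gen n x • v = 0

theorem EventuallyKilled.add {v w : Fock n} (hv : EventuallyKilled v) (hw : EventuallyKilled w) :
    EventuallyKilled (v + w) := by
  obtain ⟨N, hN⟩ := hv
  obtain ⟨M, hM⟩ := hw
  refine ⟨max N M, fun x hx => ?_⟩
  rw [smul_add, hN x (le_of_max_le_left hx), hM x (le_of_max_le_right hx), add_zero]

theorem EventuallyKilled.algebraMap_smul {v : Fock n} (hv : EventuallyKilled v) (c : ℂ) :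
    EventuallyKilled (algebraMap ℂ (Lam n) c • v) := by
  obtain ⟨N, hN⟩ := hv
  refine ⟨N, fun x hx => ?_⟩
  rw [smul_smul, ← Algebra.commutes, mul_smul, hN x hx, smul_zero]

theorem EventuallyKilled.gen_smul {v : Fock n} (hv : EventuallyKilled v) (y : TGen n) :
    EventuallyKilled (gen n y • v) := by
  obtain ⟨N, hN⟩ := hv
  refine ⟨max N (1 - y.idx), fun x hx => ?_⟩
  have hxv := hN x (le_of_max_le_left hx)
  have hxy : x.idx + y.idx ≠ 0 := by
    have := le_of_max_le_right hx
    omega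
  rw [smul_smul]
  rcases gen_mul_gen_eq_or_eq_neg x y hxy with h | h
  · rw [h, mul_smul, hxv, smul_zero]
  · rw [h, neg_smul, mul_smul, hxv, smul_zero, neg_zero]

theorem EventuallyKilled.smul (a : Lam n) {v : Fock n} (hv : EventuallyKilled v) :
    EventuallyKilled (a • v) := by
  obtain ⟨b, rfl⟩ := RingQuot.mkAlgHom_surjective ℂ (TRel n) a
  induction b using FreeAlgebra.induction generalizing v with
  | grade0 c =>
    rw [AlgHom.commutes]
    exact hv.algebraMap_smul c
  | grade1 y => exact hv.gen_smul y
  | mul a b ha hb =>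
    rw [map_mul, mul_smul]
    exact ha (hb hv)
  | add a b ha hb =>
    rw [map_add, add_smul]
    exact (ha hv).add (hb hv)

theorem eventuallyKilled (v : Fock n) : EventuallyKilled v := by
  obtain ⟨a, rfl⟩ := Submodule.Quotient.mk_surjective _ v
  have h : EventuallyKilled (Submodule.Quotient.mk 1 : Fock n) := by
    refine ⟨1, fun x hx => ?_⟩
    rw [← Submodule.Quotient.mk_smul, Submodule.Quotient.mk_eq_zero, smul_eq_mul, mul_one]
    exact Submodule.subset_span ⟨x, hx, rfl⟩
  simpa [← Submodule.Quotient.mk_smul] using h.smul a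

/-- A series of elements of `Lam n` whose terms of large index kill any given vector. -/
def IsModeField (x : ℤ → Lam n) : Prop :=
  ∀ v : Fock n, ∃ N : ℤ, ∀ k, N ≤ k → x k • v = 0

theorem isModeField_unS (u : BL n) : IsModeField (unS n u) := fun v =>
  (eventuallyKilled v).imp fun _ hN _ hk => hN _ hk

theorem isModeField_stS (u : BL n) : IsModeField (stS n u) := fun v =>
  (eventuallyKilled v).imp fun _ hN _ hk => hN _ hk

theorem isModeField_eS : IsModeField (eS n) := fun v =>
  (eventuallyKilled v).imp fun _ hN _ hk => hN _ hk

theorem isModeField_zero : IsModeField (0 : ℤ → Lam n) := fun v => ⟨0, fun _ _ => zero_smul _ v⟩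

theorem isModeField_epU (i : ℕ) : IsModeField (epU n i) := by
  unfold epU
  split_ifs
  exacts [isModeField_unS _, isModeField_zero]

theorem isModeField_epSt (i : ℕ) : IsModeField (epSt n i) := by
  unfold epSt
  split_ifs
  exacts [isModeField_stS _, isModeField_zero]

/-- A family of elements of `Lam n` whose sum is a well-defined operator on `Fock n`. -/
def IsLocallyFinite (f : ℤ → Lam n) : Prop :=
  ∀ v : Fock n, (Function.support fun k => f k • v).Finite

theorem IsModeField.isLocallyFinite_nob {x y : ℤ → Lam n} (hx : IsModeField x) (hy : IsModeField y)
    (c : ℂ) (m : ℤ) : IsLocallyFinite fun k => c • nob n x y k (m - k) := by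
  intro v
  obtain ⟨N, hN⟩ := hx v
  obtain ⟨M, hM⟩ := hy v
  refine (Set.finite_Icc (min (m - M) 0) (max N 0)).subset fun k hk => ?_
  by_contra hk'
  refine hk ?_
  have h : nob n x y k (m - k) • v = 0 := by
    rw [Set.mem_Icc, not_and_or, not_le, not_le, lt_min_iff, max_lt_iff] at hk'
    unfold nob
    rcases hk' with ⟨h₁, h₂⟩ | ⟨h₁, h₂⟩
    · rw [if_pos h₂, mul_smul, hM _ (by omega), smul_zero]
    · rw [if_neg (by omega), if_pos h₂, mul_smul, hN _ h₁.le, smul_zero]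
  change (c • nob n x y k (m - k)) • v = 0
  rw [Algebra.smul_def, mul_smul, h, smul_zero]

theorem IsLocallyFinite.sumOp_add {f : ℤ → Lam n} (hf : IsLocallyFinite f) (v w : Fock n) :
    sumOp n f (v + w) = sumOp n f v + sumOp n f w := by
  simp only [sumOp, smul_add]
  exact finsum_add_distrib (hf v) (hf w)

theorem IsLocallyFinite.sumOp_smul {f : ℤ → Lam n} (hf : IsLocallyFinite f) {a : Lam n}
    (h : ∀ k, Commute (f k) a) (v : Fock n) : sumOp n f (a • v) = a • sumOp n f v := by
  simp only [sumOp]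
  rw [smul_finsum' a (hf v)]
  exact finsum_congr fun k => by rw [smul_smul, (h k).eq, mul_smul]

theorem IsLocallyFinite.sumOp_comm {f g : ℤ → Lam n} (hf : IsLocallyFinite f)
    (hg : IsLocallyFinite g) (h : ∀ k l, Commute (f k) (g l)) (v : Fock n) :
    sumOp n f (sumOp n g v) = sumOp n g (sumOp n f v) := by
  calc sumOp n f (∑ᶠ l, g l • v) = ∑ᶠ l, sumOp n f (g l • v) :=
        (AddMonoidHom.mk' (sumOp n f) hf.sumOp_add).map_finsum (hg v)
    _ = ∑ᶠ l, g l • sumOp n f v := finsum_congr fun l => hf.sumOp_smul (fun k => h k l) v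

/-- Normally ordered quadratic operators built from mutually commuting fields commute. -/
theorem sumOp_nob_comm {x y z w : ℤ → Lam n} (hx : IsModeField x) (hy : IsModeField y)
    (hz : IsModeField z) (hw : IsModeField w) (hxz : ∀ k l, Commute (x k) (z l))
    (hxw : ∀ k l, Commute (x k) (w l)) (hyz : ∀ k l, Commute (y k) (z l))
    (hyw : ∀ k l, Commute (y k) (w l)) (c d : ℂ) (m m' : ℤ) (v : Fock n) :
    sumOp n (fun k => c • nob n x y k (m - k)) (sumOp n (fun k => d • nob n z w k (m' - k)) v) =
      sumOp n (fun k => d • nob n z w k (m' - k))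
        (sumOp n (fun k => c • nob n x y k (m - k)) v) := by
  refine (hx.isLocallyFinite_nob hy c m).sumOp_comm (hz.isLocallyFinite_nob hw d m')
    (fun k l => ?_) v
  refine Commute.smul_left (Commute.smul_right ?_ d) c
  exact commute_nob (fun l => (commute_nob (fun k => (hxz k l).symm) (fun k => (hyz k l).symm)
    _ _).symm) (fun l => (commute_nob (fun k => (hxw k l).symm) (fun k => (hyw k l).symm)
    _ _).symm) _ _

end LocalFiniteness

section RootVectors

variable {n : ℕ}

theorem xp_zero (m : ℤ) : xp n 0 m =
    sumOp n fun k => (2⁻¹ : ℂ) • nob n (stS n none) (stS n none) k (m - k) :=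
  if_pos rfl

theorem xm_zero (m : ℤ) : xm n 0 m =
    sumOp n fun k => (2⁻¹ : ℂ) • nob n (unS n none) (unS n none) k (m - k) :=
  if_pos rfl

theorem xp_self (hn : n ≠ 0) (m : ℤ) : xp n n m =
    sumOp n fun k => ((Real.sqrt 2 : ℝ) : ℂ) • nob n (epU n n) (eS n) k (m - k) := by
  simp only [xp, if_neg hn, if_true, nob_eq_mul (epU_commute_eS n)]

theorem xm_self (hn : n ≠ 0) (m : ℤ) : xm n n m =
    sumOp n fun k => (-((Real.sqrt 2 : ℝ) : ℂ)) • nob n (epSt n n) (eS n) k (m - k) := by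
  simp only [xm, if_neg hn, if_true, nob_eq_mul (epSt_commute_eS n)]

theorem xp_of_ne {i : ℕ} (h₀ : i ≠ 0) (h : i ≠ n) (m : ℤ) : xp n i m =
    sumOp n fun k => (1 : ℂ) • nob n (epU n i) (epSt n (i + 1)) k (m - k) := by
  simp only [xp, if_neg h₀, if_neg h, one_smul]

theorem xm_of_ne {i : ℕ} (h₀ : i ≠ 0) (h : i ≠ n) (m : ℤ) : xm n i m =
    sumOp n fun k => (-1 : ℂ) • nob n (epU n (i + 1)) (epSt n i) k (m - k) := by
  simp only [xm, if_neg h₀, if_neg h]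
  exact congrArg _ (funext fun k => (neg_one_smul ℂ (nob n _ _ k (m - k))).symm)

end RootVectors

/-- For all 0 ≤ i, j ≤ n with i ≠ j and all m, m' ∈ ℤ,
[x_i^+(m), x_j^−(m')] = 0 on the Fock module V. -/
theorem mixed_root_vectors_commute (n : ℕ) (hn : 1 ≤ n) (i j : ℕ) (hi : i ≤ n) (hj : j ≤ n)
    (hij : i ≠ j) (m m' : ℤ) (v : Fock n) :
    xp n i m (xm n j m' v) - xm n j m' (xp n i m v) = 0 := by
  have hn₀ : n ≠ 0 := by omega
  rw [sub_eq_zero]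
  rcases eq_or_ne i 0 with rfl | hi₀
  · have hj₀ : j ≠ 0 := hij.symm
    rw [xp_zero]
    rcases eq_or_ne j n with rfl | hjn
    · rw [xm_self hn₀]
      exact sumOp_nob_comm (isModeField_stS _) (isModeField_stS _) (isModeField_epSt _) isModeField_eS
        (fun k l => (epSt_commute_stS _ _ l k).symm) (gen_st_commute_e _)
        (fun k l => (epSt_commute_stS _ _ l k).symm) (gen_st_commute_e _) _ _ _ _ _
    · have hj₁ : j + 1 ≠ 1 := by omega
      rw [xm_of_ne hj₀ hjn]
      exact sumOp_nob_comm (isModeField_stS _) (isModeField_stS _)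
        (isModeField_epU _) (isModeField_epSt _)
        (fun k l => (epU_commute_stS_none hj₁ l k).symm)
        (fun k l => (epSt_commute_stS _ _ l k).symm)
        (fun k l => (epU_commute_stS_none hj₁ l k).symm)
        (fun k l => (epSt_commute_stS _ _ l k).symm) _ _ _ _ _
  rcases eq_or_ne i n with rfl | hin
  · rw [xp_self hn₀]
    rcases eq_or_ne j 0 with rfl | hj₀
    · rw [xm_zero]
      exact sumOp_nob_comm (isModeField_epU _) isModeField_eS (isModeField_unS _) (isModeField_unS _)
        (epU_commute_unS _ _) (epU_commute_unS _ _)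
        (fun k l => (gen_un_commute_e _ l k).symm) (fun k l => (gen_un_commute_e _ l k).symm)
        _ _ _ _ _
    · rw [xm_of_ne hj₀ hij.symm]
      exact sumOp_nob_comm (isModeField_epU _) isModeField_eS (isModeField_epU _) (isModeField_epSt _)
        (epU_commute_epU _ _) (epU_commute_epSt hij)
        (fun k l => (epU_commute_eS _ l k).symm) (fun k l => (epSt_commute_eS _ l k).symm)
        _ _ _ _ _
  rw [xp_of_ne hi₀ hin]
  rcases eq_or_ne j 0 with rfl | hj₀
  · have hi₁ : i + 1 ≠ 1 := by omega
    rw [xm_zero]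
    exact sumOp_nob_comm (isModeField_epU _) (isModeField_epSt _)
      (isModeField_unS _) (isModeField_unS _)
      (epU_commute_unS _ _) (epU_commute_unS _ _)
      (fun k l => (unS_none_commute_epSt hi₁ l k).symm)
      (fun k l => (unS_none_commute_epSt hi₁ l k).symm) _ _ _ _ _
  rcases eq_or_ne j n with rfl | hjn
  · rw [xm_self hn₀]
    exact sumOp_nob_comm (isModeField_epU _) (isModeField_epSt _) (isModeField_epSt _) isModeField_eS
      (epU_commute_epSt hij) (epU_commute_eS _) (epSt_commute_epSt _ _) (epSt_commute_eS _)
      _ _ _ _ _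
  · have hij₁ : j + 1 ≠ i + 1 := by omega
    rw [xm_of_ne hj₀ hjn]
    exact sumOp_nob_comm (isModeField_epU _) (isModeField_epSt _)
      (isModeField_epU _) (isModeField_epSt _)
      (epU_commute_epU _ _) (epU_commute_epSt hij)
      (fun k l => (epU_commute_epSt hij₁ l k).symm) (epSt_commute_epSt _ _) _ _ _ _ _
end
end
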